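/- Let A be a prime unital alternative *-algebra over ℂ containing a nontrivial symmetric idempotent e, and let Φ : A → A be a map satisfying the *-Jordan n-derivation identity in the last two slots. Then Φ is an additive *-derivation, i.e., Φ(a + b) = Φ(a) + Φ(b), Φ(ab) = Φ(a)b + aΦ(b), and Φ(a*) = Φ(a)* for all a, b ∈ A. -/

import Mathlib

/-- The Jordan `•`-product `a • b = ab + b a*`. -/
def starJordan {A : Type*} [NonAssocRing A] [StarRing A] (a b : A) : A :=
  a * b + b * star a

/-- Left-normed iterated Jordan `•`-product of a list (empty list ↦ 0, junk value). -/
def leftStarJordan {A : Type*} [NonAssocRing A] [StarRing A] : List A → A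
  | [] => 0
  | x :: xs => xs.foldl starJordan x

/-- The family `a₁ = ⋯ = a_{n-2} = 1`, `a_{n-1} = x`, `a_n = y`. -/
def lastTwoFamily {A : Type*} [One A] (n : ℕ) (x y : A) : Fin n → A :=
  fun i => if (i : ℕ) = n - 2 then x else if (i : ℕ) = n - 1 then y else 1

/-- `e₁ = e`, `e₂ = 1 - e`. -/
def peirceIdem {A : Type*} [NonAssocRing A] (e : A) : Fin 2 → A :=
  fun i => if i = 0 then e else 1 - e

/-- Membership in the Peirce component `A_{ij}`: `eᵢ x = x` and `x eⱼ = x`. -/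
def inPeirce {A : Type*} [NonAssocRing A] (e : A) (i j : Fin 2) (x : A) : Prop :=
  peirceIdem e i * x = x ∧ x * peirceIdem e j = x

/-- The inner derivation `Ξ_{y,z}(a) = y(za) − z(ya) + y(az) − (ya)z + (az)y − (ay)z`. -/
def innerDer {A : Type*} [NonAssocRing A] (y z a : A) : A :=
  y * (z * a) - z * (y * a) + y * (a * z) - (y * a) * z + (a * z) * y - (a * y) * z

/-- The alternative laws. -/
structure IsAlternative (A : Type*) [NonAssocRing A] : Prop where
  left : ∀ a b : A, a * a * b = a * (a * b)
  right : ∀ a b : A, b * a * a = b * (a * a)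

/-- `x` is a simultaneous eigenvector of left and right multiplication by `e`, with integer
eigenvalues `i` and `j`. -/
structure IsPeirce {A : Type*} [NonAssocRing A] (e : A) (i j : ℤ) (x : A) : Prop where
  left : e * x = i • x
  right : x * e = j • x

section Peirce

variable {A : Type*} [NonAssocRing A]

theorem IsAlternative.associator_swap_left (h : IsAlternative A) (a b c : A) :
    associator a b c = -associator b a c := by
  have h₁ := h.left (a + b) c
  have h₂ := h.left a c
  have h₃ := h.left b c
  simp only [associator_apply, mul_add, add_mul] at *
  grind

theorem IsAlternative.associator_swap_right (h : IsAlternative A) (a b c : A) :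
    associator a b c = -associator a c b := by
  have h₁ := h.right (b + c) a
  have h₂ := h.right b a
  have h₃ := h.right c a
  simp only [associator_apply, mul_add, add_mul] at *
  grind

theorem IsAlternative.flexible (h : IsAlternative A) (a b : A) : a * b * a = a * (b * a) := by
  have h₁ := h.associator_swap_left a b a
  have h₂ := h.right a b
  simp only [associator_apply] at h₁
  grind

/-- A biadditive map that interacts with the multiplications by `e` like the product of an
alternative ring does. -/
structure IsPeirceGraded (e : A) (B : A →+ A →+ A) : Prop where
  left : ∀ y z, e * B y z = B (e * y + y * e) z - B y (e * z)
  right : ∀ y z, B y z * e = B y (e * z + z * e) - B (y * e) z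

theorem IsAlternative.isPeirceGraded_mul (h : IsAlternative A) (e : A) :
    IsPeirceGraded e AddMonoidHom.mul where
  left y z := by
    have := h.associator_swap_left e y z
    simp only [associator_apply, AddMonoidHom.mul_apply, add_mul] at *
    grind
  right y z := by
    have := h.associator_swap_right y e z
    simp only [associator_apply, AddMonoidHom.mul_apply, mul_add] at *
    grind

variable {e : A}

theorem IsPeirceGraded.isPeirce {B : A →+ A →+ A} (hB : IsPeirceGraded e B) {i j k l : ℤ} {y z : A}
    (hy : IsPeirce e i j y) (hz : IsPeirce e k l z) :
    IsPeirce e (i + j - k) (k + l - j) (B y z) where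
  left := by
    rw [hB.left, hy.left, hy.right, hz.left]
    simp only [map_add, map_zsmul, AddMonoidHom.add_apply, AddMonoidHom.zsmul_apply]
    module
  right := by
    rw [hB.right, hy.right, hz.left, hz.right]
    simp only [map_add, map_zsmul, AddMonoidHom.zsmul_apply]
    module

theorem IsAlternative.isPeirce_mul (h : IsAlternative A) {i j k l : ℤ} {y z : A}
    (hy : IsPeirce e i j y) (hz : IsPeirce e k l z) :
    IsPeirce e (i + j - k) (k + l - j) (y * z) :=
  (h.isPeirceGraded_mul e).isPeirce hy hz

theorem IsPeirce.zero (i j : ℤ) : IsPeirce e i j 0 := ⟨by simp, by simp⟩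

theorem IsPeirce.add {i j : ℤ} {x y : A} (hx : IsPeirce e i j x) (hy : IsPeirce e i j y) :
    IsPeirce e i j (x + y) where
  left := by rw [mul_add, hx.left, hy.left, smul_add]
  right := by rw [add_mul, hx.right, hy.right, smul_add]

theorem IsPeirce.neg {i j : ℤ} {x : A} (hx : IsPeirce e i j x) : IsPeirce e i j (-x) where
  left := by rw [mul_neg, hx.left, smul_neg]
  right := by rw [neg_mul, hx.right, smul_neg]

theorem IsPeirce.nsmul {i j : ℤ} {x : A} (hx : IsPeirce e i j x) (n : ℕ) :
    IsPeirce e i j (n • x) where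
  left := by rw [mul_smul_comm, hx.left, smul_comm]
  right := by rw [smul_mul_assoc, hx.right, smul_comm]

theorem IsPeirce.one_sub {i j : ℤ} {x : A} (hx : IsPeirce e i j x) :
    IsPeirce (1 - e) (1 - i) (1 - j) x where
  left := by rw [sub_mul, one_mul, hx.left]; module
  right := by rw [mul_sub, mul_one, hx.right]; module

theorem IsPeirce.star [StarRing A] (he : star e = e) {i j : ℤ} {x : A} (hx : IsPeirce e i j x) :
    IsPeirce e j i (star x) where
  left := by have := congrArg Star.star hx.right; rwa [star_mul, he, star_zsmul] at this
  right := by have := congrArg Star.star hx.left; rwa [star_mul, he, star_zsmul] at this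

/-- Every element is the sum of its four Peirce components. -/
theorem exists_peirce_decomposition (h : IsAlternative A) (he : e * e = e) (x : A) :
    ∃ a b c d : A, IsPeirce e 1 1 a ∧ IsPeirce e 1 0 b ∧ IsPeirce e 0 1 c ∧ IsPeirce e 0 0 d ∧
      x = a + b + c + d := by
  have h₁ : e * (e * x) = e * x := by rw [← h.left, he]
  have h₂ : x * e * e = x * e := by rw [h.right, he]
  have h₃ := h.flexible e x
  have h₄ : e * (e * x * e) = e * x * e := by rw [h₃, ← h.left, he]
  have h₅ : e * x * e * e = e * x * e := by rw [h.right, he]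
  refine ⟨e * x * e, e * x - e * x * e, x * e - e * x * e, x - e * x - x * e + e * x * e,
    ⟨?_, ?_⟩, ⟨?_, ?_⟩, ⟨?_, ?_⟩, ⟨?_, ?_⟩, by abel⟩ <;>
  simp only [mul_sub, sub_mul, mul_add, add_mul, one_smul, zero_smul, h₁, h₂, h₄, h₅, ← h₃] <;>
  abel

variable [IsAddTorsionFree A]

theorem IsPeirce.eq_zero_of_ne {i j k l : ℤ} {x : A} (hx : IsPeirce e i j x)
    (hx' : IsPeirce e k l x) (hne : i ≠ k ∨ j ≠ l) : x = 0 := by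
  rcases hne with hne | hne
  · have : (i - k) • x = 0 := by rw [sub_smul, ← hx.left, ← hx'.left, sub_self]
    exact (smul_eq_zero.mp this).resolve_left (sub_ne_zero.mpr hne)
  · have : (j - l) • x = 0 := by rw [sub_smul, ← hx.right, ← hx'.right, sub_self]
    exact (smul_eq_zero.mp this).resolve_left (sub_ne_zero.mpr hne)

theorem IsPeirce.eq_zero (h : IsAlternative A) (he : e * e = e) {i j : ℤ} {x : A}
    (hx : IsPeirce e i j x) (hij : i * i ≠ i ∨ j * j ≠ j) : x = 0 := by
  have h₁ := h.left e x
  have h₂ := h.right e x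
  rw [he, hx.left, mul_smul_comm, hx.left, smul_smul] at h₁
  rw [he, hx.right, smul_mul_assoc, hx.right, smul_smul] at h₂
  rcases hij with hij | hij
  · have : (i * i - i) • x = 0 := by rw [sub_smul, ← h₁, sub_self]
    exact (smul_eq_zero.mp this).resolve_left (sub_ne_zero.mpr hij)
  · have : (j * j - j) • x = 0 := by rw [sub_smul, h₂, sub_self]
    exact (smul_eq_zero.mp this).resolve_left (sub_ne_zero.mpr hij)

theorem IsPeirce.eq_zero_of_mul_eq_zero (h : IsAlternative A)
    (hprime : ∀ a b : A, (∀ r : A, a * r * b = 0) → a = 0 ∨ b = 0)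
    (he : e * e = e) (he1 : e ≠ 1) {t : A} (ht : IsPeirce e 1 1 t)
    (h₀ : ∀ x, IsPeirce e 1 0 x → t * x = 0) : t = 0 := by
  refine (hprime t (1 - e) fun r => ?_).resolve_right (sub_ne_zero.mpr he1.symm)
  obtain ⟨a, b, c, d, ha, hb, hc, hd, rfl⟩ := exists_peirce_decomposition h he r
  have hta := (h.isPeirce_mul ht ha).right
  have htc := (h.isPeirce_mul ht hc).eq_zero h he (by norm_num)
  have htd := (h.isPeirce_mul ht hd).eq_zero h he (by norm_num)
  rw [mul_add, mul_add, mul_add, htd, htc, h₀ b hb, mul_sub, mul_one]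
  simpa [sub_eq_zero] using hta.symm

end Peirce

/-- The failure of `Φ` to be additive at `(a, b)`. -/
def addDefect {A : Type*} [AddCommGroup A] (Φ : A → A) (a b : A) : A :=
  Φ (a + b) - Φ a - Φ b

theorem addDefect_comm {A : Type*} [AddCommGroup A] (Φ : A → A) (a b : A) :
    addDefect Φ a b = addDefect Φ b a := by
  rw [addDefect, addDefect, add_comm a b, sub_right_comm]

/-- A Leibniz-type rule for `•` in which the two defects of additivity agree up to the factor
`N`. -/
structure IsJordanLeibniz {A : Type*} [NonAssocRing A] [StarRing A] (N : ℕ) (Φ Ψ : A → A) :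
    Prop where
  ne_zero : N ≠ 0
  map_jordan : ∀ x y, Φ (N • starJordan x y) = starJordan (Ψ x) y + N • starJordan x (Φ y)
  addDefect_eq : ∀ a b, addDefect Ψ a b = N • addDefect Φ a b

namespace IsJordanLeibniz

variable {A : Type*} [NonAssocRing A] [StarRing A] {N : ℕ} {Φ Ψ : A → A}

theorem map_zero (hJ : IsJordanLeibniz N Φ Ψ) : Φ 0 = 0 := by
  simpa [starJordan] using hJ.map_jordan 0 0

theorem addDefect_zero_left (hJ : IsJordanLeibniz N Φ Ψ) (b : A) : addDefect Φ 0 b = 0 := by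
  simp [addDefect, hJ.map_zero]

theorem addDefect_zero_right (hJ : IsJordanLeibniz N Φ Ψ) (a : A) : addDefect Φ a 0 = 0 := by
  simp [addDefect, hJ.map_zero]

theorem addDefect_jordan_left (hJ : IsJordanLeibniz N Φ Ψ) (x a b : A) :
    addDefect Φ (N • starJordan x a) (N • starJordan x b) = N • starJordan x (addDefect Φ a b) := by
  have h : starJordan x (a + b) = starJordan x a + starJordan x b := by
    simp only [starJordan, mul_add, add_mul]; abel
  rw [addDefect, ← smul_add, ← h, hJ.map_jordan, hJ.map_jordan, hJ.map_jordan]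
  simp only [starJordan, addDefect, mul_add, add_mul, sub_mul, mul_sub]
  module

theorem addDefect_jordan_right (hJ : IsJordanLeibniz N Φ Ψ) (x a b : A) :
    addDefect Φ (N • starJordan a x) (N • starJordan b x) = N • starJordan (addDefect Φ a b) x := by
  have h : starJordan (a + b) x = starJordan a x + starJordan b x := by
    simp only [starJordan, star_add, mul_add, add_mul]; abel
  have hd : Ψ (a + b) = Ψ a + Ψ b + N • addDefect Φ a b := by
    rw [← hJ.addDefect_eq, addDefect]; abel
  rw [addDefect, ← smul_add, ← h, hJ.map_jordan, hJ.map_jordan, hJ.map_jordan, hd]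
  simp only [starJordan, addDefect, star_add, star_sub, star_nsmul, mul_add, add_mul, sub_mul,
    mul_sub, smul_mul_assoc, mul_smul_comm]
  module

variable [IsAddTorsionFree A] {e : A}

theorem jordan_addDefect_eq_zero (hJ : IsJordanLeibniz N Φ Ψ) {x a b : A}
    (h : addDefect Φ (N • starJordan x a) (N • starJordan x b) = 0) :
    starJordan x (addDefect Φ a b) = 0 := by
  rw [hJ.addDefect_jordan_left] at h
  exact (smul_eq_zero.mp h).resolve_left hJ.ne_zero

theorem addDefect_jordan_eq_zero (hJ : IsJordanLeibniz N Φ Ψ) {x a b : A}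
    (h : addDefect Φ (N • starJordan a x) (N • starJordan b x) = 0) :
    starJordan (addDefect Φ a b) x = 0 := by
  rw [hJ.addDefect_jordan_right] at h
  exact (smul_eq_zero.mp h).resolve_left hJ.ne_zero

/-- If `a` or `b` is an eigenvector of `y ↦ e y + y e`, then the defect at `(a, b)` is one for the
same eigenvalue. -/
theorem anticommute_addDefect (hJ : IsJordanLeibniz N Φ Ψ) (he : star e = e) (k : ℤ) {a b : A}
    (h : e * a + a * e = k • a ∨ e * b + b * e = k • b) :
    e * addDefect Φ a b + addDefect Φ a b * e = k • addDefect Φ a b := by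
  have hs : ∀ y, starJordan (2 • e - (k : A)) y = 2 • (e * y + y * e - k • y) := by
    intro y
    simp only [starJordan, star_sub, star_nsmul, he, star_intCast, sub_mul, mul_sub,
      smul_mul_assoc, mul_smul_comm, zsmul_eq_mul, smul_sub, smul_add, (Int.cast_commute k y).eq]
    module
  have h₀ : starJordan (2 • e - (k : A)) (addDefect Φ a b) = 0 := by
    apply hJ.jordan_addDefect_eq_zero
    rcases h with h | h
    · rw [hs a, h, sub_self, smul_zero, smul_zero, hJ.addDefect_zero_left]
    · rw [hs b, h, sub_self, smul_zero, smul_zero, hJ.addDefect_zero_right]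
  rw [hs] at h₀
  exact sub_eq_zero.mp ((smul_eq_zero.mp h₀).resolve_left two_ne_zero)

/-- The defect vanishes at pairs of eigenvectors with distinct eigenvalues. -/
theorem addDefect_eq_zero_of_ne (hJ : IsJordanLeibniz N Φ Ψ) (he : star e = e) {k l : ℤ}
    (hkl : k ≠ l) {a b : A} (ha : e * a + a * e = k • a) (hb : e * b + b * e = l • b) :
    addDefect Φ a b = 0 := by
  have h₁ := hJ.anticommute_addDefect he k (b := b) (Or.inl ha)
  have h₂ := hJ.anticommute_addDefect he l (a := a) (Or.inr hb)
  rw [h₁, ← sub_eq_zero, ← sub_smul] at h₂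
  exact (smul_eq_zero.mp h₂).resolve_left (sub_ne_zero.mpr hkl)

theorem addDefect_diag_offDiag (hJ : IsJordanLeibniz N Φ Ψ) (hs : star e = e) {a d v : A}
    (ha : IsPeirce e 1 1 a) (hd : IsPeirce e 0 0 d) (hv : e * v + v * e = v) :
    addDefect Φ (a + d) v = 0 := by
  have h₁ := hJ.anticommute_addDefect hs 1 (a := a + d) (b := v) (Or.inr (by rw [hv, one_smul]))
  have h₂ : starJordan e (addDefect Φ (a + d) v) = 0 := by
    apply hJ.jordan_addDefect_eq_zero
    have h₃ : starJordan e (a + d) = 2 • a := by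
      simp only [starJordan, hs, mul_add, add_mul, ha.left, ha.right, hd.left, hd.right]
      module
    have h₄ : starJordan e v = v := by rw [starJordan, hs, hv]
    rw [h₃, h₄]
    refine hJ.addDefect_eq_zero_of_ne hs (k := 2) (l := 1) (by norm_num) ?_ ?_
    · simp only [mul_smul_comm, smul_mul_assoc, ha.left, ha.right]
      module
    · rw [mul_smul_comm, smul_mul_assoc, ← smul_add, hv, one_smul]
  rw [starJordan, hs, h₁, one_smul] at h₂
  exact h₂

theorem isPeirce_addDefect (hJ : IsJordanLeibniz N Φ Ψ) (h : IsAlternative A) (hs : star e = e)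
    (he : e * e = e) {a : A} (ha : IsPeirce e 1 0 a) (b : A) :
    IsPeirce e 1 0 (addDefect Φ a b) := by
  have h₁ := hJ.anticommute_addDefect hs 1 (a := a) (b := b)
    (Or.inl (by rw [ha.left, ha.right]; module))
  have h₂ : starJordan (addDefect Φ a b) e = 0 := by
    apply hJ.addDefect_jordan_eq_zero
    rw [starJordan, ha.right, (ha.star hs).left, zero_smul, zero_smul, add_zero, smul_zero,
      hJ.addDefect_zero_left]
  generalize addDefect Φ a b = t at *
  have h₃ := h.left e (star t)
  have h₄ := h.left e t
  rw [he] at h₃ h₄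
  rw [starJordan] at h₂
  have h₅ : e * (t * e) = t * e := by
    rw [eq_neg_of_add_eq_zero_left h₂, mul_neg, ← h₃]
  have h₆ := congrArg (e * ·) h₁
  simp only [mul_add, h₅, ← h₄, one_smul] at h₆
  have h₇ : t * e = 0 := by grind
  exact ⟨by rw [h₇, add_zero] at h₁; exact h₁, by rw [h₇, zero_smul]⟩

theorem addDefect_eq_zero_of_peirce (hJ : IsJordanLeibniz N Φ Ψ) (h : IsAlternative A)
    (hs : star e = e) (he : e * e = e) {a b : A} (ha : IsPeirce e 1 0 a) (hb : IsPeirce e 0 1 b) :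
    addDefect Φ a b = 0 := by
  have hs' : star (1 - e) = 1 - e := by rw [star_sub, star_one, hs]
  have he' : (1 - e) * (1 - e) = 1 - e := by simp [mul_sub, sub_mul, he]
  have h₁ := hJ.isPeirce_addDefect h hs he ha b
  have h₂ := (hJ.isPeirce_addDefect h hs' he' (by simpa using hb.one_sub) a).one_sub
  rw [addDefect_comm] at h₂
  exact h₁.eq_zero_of_ne (by simpa using h₂) (by norm_num)

/-- `Φ` is additive along the Peirce decomposition. -/
theorem map_peirce_sum (hJ : IsJordanLeibniz N Φ Ψ) (h : IsAlternative A) (hs : star e = e)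
    (he : e * e = e) {a b c d : A} (ha : IsPeirce e 1 1 a) (hb : IsPeirce e 1 0 b)
    (hc : IsPeirce e 0 1 c) (hd : IsPeirce e 0 0 d) :
    Φ (a + b + c + d) = Φ a + Φ b + Φ c + Φ d := by
  have h₁ := hJ.addDefect_diag_offDiag hs ha hd (v := b + c) (by
    simp only [mul_add, add_mul, hb.left, hb.right, hc.left, hc.right]; module)
  have h₂ := hJ.addDefect_eq_zero_of_ne hs (k := 2) (l := 0) (by norm_num) (a := a) (b := d)
    (by rw [ha.left, ha.right]; module) (by rw [hd.left, hd.right]; module)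
  have h₃ := hJ.addDefect_eq_zero_of_peirce h hs he hb hc
  rw [show a + b + c + d = a + d + (b + c) by abel]
  simp only [addDefect] at h₁ h₂ h₃
  grind

/-- `Φ` is additive on the Peirce component `A₁₀`, up to a scalar. -/
theorem addDefect_nsmul_eq_zero (hJ : IsJordanLeibniz N Φ Ψ) (h : IsAlternative A)
    (hs : star e = e) (he : e * e = e) {a b : A} (ha : IsPeirce e 1 0 a) (hb : IsPeirce e 1 0 b) :
    addDefect Φ (N • a) (N • b) = 0 := by
  have hs' : star (1 - e) = 1 - e := by rw [star_sub, star_one, hs]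
  have he' : (1 - e) * (1 - e) = 1 - e := by simp [mul_sub, sub_mul, he]
  have hsa := ha.star hs
  have hab := h.isPeirce_mul ha hb
  have hba := h.isPeirce_mul hb hsa
  norm_num at hab hba
  have hx : starJordan (e + a) (1 - e) = a + star a := by
    simp only [starJordan, star_add, hs, mul_sub, sub_mul, mul_add, add_mul, mul_one, one_mul, he,
      ha.right, hsa.left]
    module
  have hy : starJordan (e + a) b = b * star a + b + a * b := by
    simp only [starJordan, star_add, hs, mul_add, add_mul, hb.left, hb.right]
    module
  have h₁ : addDefect Φ (N • starJordan (e + a) (1 - e)) (N • starJordan (e + a) b) = 0 := by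
    rw [hJ.addDefect_jordan_left, hJ.addDefect_eq_zero_of_ne hs (k := 0) (l := 1) (by norm_num)]
    · simp [starJordan]
    · simp [mul_sub, sub_mul, he]
    · rw [hb.left, hb.right]; module
  have h₂ := hJ.map_peirce_sum h hs he (hba.nsmul N) ((ha.add hb).nsmul N)
    ((hsa.add hab).nsmul N) (IsPeirce.zero 0 0)
  have h₃ := hJ.map_peirce_sum h hs he (hba.nsmul N) (hb.nsmul N) (hab.nsmul N) (IsPeirce.zero 0 0)
  have h₄ := hJ.map_peirce_sum h hs he (IsPeirce.zero 1 1) (ha.nsmul N) (hsa.nsmul N)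
    (IsPeirce.zero 0 0)
  have h₅ := hJ.isPeirce_addDefect h hs he (ha.nsmul N) (N • b)
  have h₆ : IsPeirce e 0 1 (addDefect Φ (N • star a) (N • (a * b))) := by
    have h₇ := hJ.isPeirce_addDefect h hs' he' (e := 1 - e)
      (by simpa using (hsa.nsmul N).one_sub) (N • (a * b))
    simpa using h₇.one_sub
  have h₇ : addDefect Φ (N • a) (N • b) + addDefect Φ (N • star a) (N • (a * b)) = 0 := by
    rw [hx, hy] at h₁
    simp only [addDefect, smul_add, add_zero, zero_add, hJ.map_zero] at h₁ h₂ h₃ h₄ ⊢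
    rw [h₃, h₄] at h₁
    rw [show N • a + N • star a + (N • (b * star a) + N • b + N • (a * b)) =
      N • (b * star a) + (N • a + N • b) + (N • star a + N • (a * b)) by abel, h₂] at h₁
    rw [← h₁]
    abel
  rw [eq_neg_of_add_eq_zero_left h₇] at h₅ ⊢
  exact h₅.eq_zero_of_ne h₆.neg (by norm_num)

theorem addDefect_eq_zero_of_offDiag (hJ : IsJordanLeibniz N Φ Ψ) (h : IsAlternative A)
    (hs : star e = e) (he : e * e = e) {a b : A} (ha : IsPeirce e 1 0 a) (hb : IsPeirce e 1 0 b) :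
    addDefect Φ a b = 0 := by
  have h₁ := hJ.addDefect_jordan_left 1 a b
  have h₂ : ∀ y : A, starJordan 1 y = 2 • y := fun y => by
    rw [starJordan, star_one, one_mul, mul_one, two_smul]
  rw [h₂, h₂, h₂, hJ.addDefect_nsmul_eq_zero h hs he (ha.nsmul 2) (hb.nsmul 2), smul_smul] at h₁
  exact (smul_eq_zero.mp h₁.symm).resolve_left (mul_ne_zero hJ.ne_zero two_ne_zero)

theorem addDefect_eq_zero_of_diag (hJ : IsJordanLeibniz N Φ Ψ) (h : IsAlternative A)
    (hprime : ∀ a b : A, (∀ r : A, a * r * b = 0) → a = 0 ∨ b = 0) (hs : star e = e)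
    (he : e * e = e) (he1 : e ≠ 1) {a b : A} (ha : IsPeirce e 1 1 a) (hb : IsPeirce e 1 1 b) :
    addDefect Φ a b = 0 := by
  have h₁ := hJ.anticommute_addDefect hs 2 (a := a) (b := b)
    (Or.inl (by rw [ha.left, ha.right]; module))
  have ht : IsPeirce e 1 1 (addDefect Φ a b) := by
    generalize addDefect Φ a b = t at *
    have h₂ := h.left e t
    have h₃ := h.right e t
    have h₄ := h.flexible e t
    have h₅ := congrArg (e * ·) h₁
    have h₆ := congrArg (· * e) h₁
    rw [he] at h₂ h₃
    simp only [mul_add, add_mul, mul_smul_comm, smul_mul_assoc, ← h₂, h₃, ← h₄] at h₅ h₆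
    constructor <;> grind
  refine ht.eq_zero_of_mul_eq_zero h hprime he he1 fun x hx => ?_
  have hx' : ∀ y, IsPeirce e 1 1 y → starJordan y x = y * x := fun y hy => by
    rw [starJordan, (h.isPeirce_mul hx (hy.star hs)).eq_zero h he (by norm_num), add_zero]
  have hm : ∀ y, IsPeirce e 1 1 y → IsPeirce e 1 0 (y * x) := fun y hy => by
    simpa using h.isPeirce_mul hy hx
  rw [← hx' _ ht]
  apply hJ.addDefect_jordan_eq_zero
  rw [hx' a ha, hx' b hb]
  exact hJ.addDefect_eq_zero_of_offDiag h hs he ((hm a ha).nsmul N) ((hm b hb).nsmul N)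

theorem map_add (hJ : IsJordanLeibniz N Φ Ψ) (h : IsAlternative A)
    (hprime : ∀ a b : A, (∀ r : A, a * r * b = 0) → a = 0 ∨ b = 0) (hs : star e = e)
    (he : e * e = e) (he0 : e ≠ 0) (he1 : e ≠ 1) (x y : A) : Φ (x + y) = Φ x + Φ y := by
  obtain ⟨a, b, c, d, ha, hb, hc, hd, rfl⟩ := exists_peirce_decomposition h he x
  obtain ⟨a', b', c', d', ha', hb', hc', hd', rfl⟩ := exists_peirce_decomposition h he y
  have hs' : star (1 - e) = 1 - e := by rw [star_sub, star_one, hs]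
  have he' : (1 - e) * (1 - e) = 1 - e := by simp [mul_sub, sub_mul, he]
  have he1' : 1 - e ≠ 1 := by simpa using he0
  have h₁ := hJ.addDefect_eq_zero_of_diag h hprime hs he he1 ha ha'
  have h₂ := hJ.addDefect_eq_zero_of_offDiag h hs he hb hb'
  have h₃ := hJ.addDefect_eq_zero_of_offDiag h hs' he' (by simpa using hc.one_sub)
    (by simpa using hc'.one_sub)
  have h₄ := hJ.addDefect_eq_zero_of_diag h hprime hs' he' he1' (by simpa using hd.one_sub)
    (by simpa using hd'.one_sub)
  simp only [addDefect, sub_sub, sub_eq_zero] at h₁ h₂ h₃ h₄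
  rw [show a + b + c + d + (a' + b' + c' + d') = a + a' + (b + b') + (c + c') + (d + d') by abel,
    hJ.map_peirce_sum h hs he (ha.add ha') (hb.add hb') (hc.add hc') (hd.add hd'),
    hJ.map_peirce_sum h hs he ha hb hc hd, hJ.map_peirce_sum h hs he ha' hb' hc' hd',
    h₁, h₂, h₃, h₄]
  abel

end IsJordanLeibniz

/-- An additive map satisfying the Leibniz rule for `•`. -/
def IsJordanStarDerivation {A : Type*} [NonAssocRing A] [StarRing A] (Φ : A →+ A) : Prop :=
  ∀ x y, Φ (starJordan x y) = starJordan (Φ x) y + starJordan x (Φ y)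

/-- The failure of `Φ` to be a derivation at `(x, y)`, namely `Φ(xy) - Φ(x)y - xΦ(y)`. -/
def mulDefect {A : Type*} [NonAssocRing A] (Φ : A →+ A) : A →+ A →+ A :=
  AddMonoidHom.mul.compr₂ Φ - AddMonoidHom.mul.comp Φ - AddMonoidHom.mul.compl₂ Φ

section MulDefect

variable {A : Type*} [NonAssocRing A]

theorem mulDefect_apply (Φ : A →+ A) (x y : A) :
    mulDefect Φ x y = Φ (x * y) - Φ x * y - x * Φ y := rfl

/-- The Hochschild coboundary of `mulDefect Φ`. -/
def mulDefectCoboundary (Φ : A →+ A) (x y z : A) : A :=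
  mulDefect Φ (x * y) z - mulDefect Φ x (y * z) + mulDefect Φ x y * z - x * mulDefect Φ y z

theorem mulDefectCoboundary_eq_associator (Φ : A →+ A) (x y z : A) :
    mulDefectCoboundary Φ x y z = Φ (associator x y z) - associator (Φ x) y z -
      associator x (Φ y) z - associator x y (Φ z) := by
  simp only [mulDefectCoboundary, mulDefect_apply, associator_apply, map_sub, sub_mul, mul_sub]
  abel

theorem mulDefectCoboundary_swap_left (h : IsAlternative A) (Φ : A →+ A) (x y z : A) :
    mulDefectCoboundary Φ x y z = -mulDefectCoboundary Φ y x z := by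
  rw [mulDefectCoboundary_eq_associator, mulDefectCoboundary_eq_associator,
    h.associator_swap_left x, h.associator_swap_left (Φ x), h.associator_swap_left x (Φ y),
    h.associator_swap_left x y (Φ z), map_neg]
  abel

theorem mulDefectCoboundary_swap_right (h : IsAlternative A) (Φ : A →+ A) (x y z : A) :
    mulDefectCoboundary Φ x y z = -mulDefectCoboundary Φ x z y := by
  rw [mulDefectCoboundary_eq_associator, mulDefectCoboundary_eq_associator,
    h.associator_swap_right x y z, h.associator_swap_right (Φ x), h.associator_swap_right x (Φ y),
    h.associator_swap_right x y (Φ z), map_neg]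
  abel

end MulDefect

namespace IsJordanStarDerivation

variable {A : Type*} [NonAssocRing A] [StarRing A] {Φ : A →+ A} {e : A}

theorem star_map_one (hΦ : IsJordanStarDerivation Φ) : star (Φ 1) = -Φ 1 := by
  have := hΦ 1 1
  simp only [starJordan, star_one, one_mul, mul_one, map_add] at this
  grind

theorem map_star (hΦ : IsJordanStarDerivation Φ) (h₁ : Φ 1 = 0) (x : A) :
    Φ (star x) = star (Φ x) := by
  have := hΦ x 1
  simp only [starJordan, h₁, one_mul, mul_one, map_add, mul_zero, zero_mul] at this
  grind

theorem mulDefect_eq_neg (hΦ : IsJordanStarDerivation Φ) (h₁ : Φ 1 = 0) (x y : A) :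
    mulDefect Φ x y = -mulDefect Φ y (star x) := by
  have := hΦ x y
  simp only [starJordan, map_add] at this
  rw [mulDefect_apply, mulDefect_apply, hΦ.map_star h₁]
  grind

theorem map_one_mul_comm (hΦ : IsJordanStarDerivation Φ) (x : A) : Φ 1 * x = x * Φ 1 := by
  have := hΦ 1 x
  simp only [starJordan, star_one, one_mul, mul_one, map_add, hΦ.star_map_one, mul_neg] at this
  grind

variable [IsAddTorsionFree A]

theorem mul_map_one_mul (hΦ : IsJordanStarDerivation Φ) {x y : A} (hx : star x = x)
    (hy : star y = y) : x * (Φ 1 * y) = y * (Φ 1 * x) := by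
  have hstar : ∀ z, star z = z → star (Φ z) = Φ z - 2 • (Φ 1 * z) := fun z hz => by
    have := hΦ z 1
    simp only [starJordan, hz, one_mul, mul_one, map_add, ← hΦ.map_one_mul_comm] at this
    grind
  have h₁ := hΦ x y
  have h₂ := hΦ y x
  simp only [starJordan, hx, hy, hstar x hx, hstar y hy, mul_sub, mul_smul_comm, map_add] at h₁ h₂
  grind

theorem map_one_mul_eq_zero (hΦ : IsJordanStarDerivation Φ) (h : IsAlternative A)
    (hprime : ∀ a b : A, (∀ r : A, a * r * b = 0) → a = 0 ∨ b = 0) (hs : star e = e)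
    (he : e * e = e) (he1 : e ≠ 1) : Φ 1 * e = 0 := by
  have hu : IsPeirce e 1 1 (Φ 1 * e) := by
    have hr : Φ 1 * e * e = Φ 1 * e := by rw [h.right, he]
    constructor
    · rw [← h.flexible, ← hΦ.map_one_mul_comm, hr, one_smul]
    · rw [hr, one_smul]
  have hw : IsPeirce e 0 0 (Φ 1 - Φ 1 * e) := by
    constructor
    · rw [mul_sub, hu.left, ← hΦ.map_one_mul_comm, one_smul, sub_self, zero_smul]
    · rw [sub_mul, hu.right, one_smul, sub_self, zero_smul]
  refine hu.eq_zero_of_mul_eq_zero h hprime he he1 fun b hb => ?_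
  have hbs := hb.star hs
  have h₁ := hΦ.mul_map_one_mul hs (y := b + star b) (by rw [star_add, star_star, add_comm])
  have h₂ : Φ 1 = Φ 1 * e + (Φ 1 - Φ 1 * e) := by abel
  generalize Φ 1 * e = u at *
  generalize Φ 1 - u = w at *
  have hub := h.isPeirce_mul hu hb
  have hbu := h.isPeirce_mul hbs hu
  have hwb := h.isPeirce_mul hw hbs
  have h₃ := (h.isPeirce_mul hw hb).eq_zero h he (by norm_num)
  have h₄ := (h.isPeirce_mul hu hbs).eq_zero h he (by norm_num)
  have h₅ := (h.isPeirce_mul hb hu).eq_zero h he (by norm_num)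
  simp only [h₂, add_mul, mul_add, h₃, h₄, h₅, hub.left, hwb.left] at h₁
  norm_num at h₁ hub hbu
  rw [h₁] at hub ⊢
  exact hbu.eq_zero_of_ne hub (by norm_num)

theorem map_one (hΦ : IsJordanStarDerivation Φ) (h : IsAlternative A)
    (hprime : ∀ a b : A, (∀ r : A, a * r * b = 0) → a = 0 ∨ b = 0) (hs : star e = e)
    (he : e * e = e) (he0 : e ≠ 0) (he1 : e ≠ 1) : Φ 1 = 0 := by
  have h₁ := hΦ.map_one_mul_eq_zero h hprime hs he he1
  have h₂ := hΦ.map_one_mul_eq_zero h hprime (e := 1 - e) (by rw [star_sub, star_one, hs])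
    (by simp [mul_sub, sub_mul, he]) (by simpa using he0)
  rwa [mul_sub, h₁, sub_zero, mul_one] at h₂

theorem mulDefect_idem (hΦ : IsJordanStarDerivation Φ) (h : IsAlternative A) (h₁ : Φ 1 = 0)
    (hs : star e = e) (he : e * e = e) (y : A) : mulDefect Φ e y = 0 := by
  have hye : ∀ y, mulDefect Φ y e = -mulDefect Φ e y := fun y => by
    rw [hΦ.mulDefect_eq_neg h₁ e y, hs, neg_neg]
  have hstar : ∀ y, mulDefect Φ e (star y) = mulDefect Φ e y := fun y => by
    rw [← neg_inj, ← hΦ.mulDefect_eq_neg h₁, hye]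
  have hee : mulDefect Φ e e = 0 := by have := hye e; grind
  have hc : ∀ {i j : ℤ} {y : A}, IsPeirce e i j y → IsPeirce e (1 - i) (1 - j) (mulDefect Φ e y) ∧
      (2 * (i + j - 1)) • mulDefect Φ e y = 0 := by
    intro i j y hy
    have c₁ := mulDefectCoboundary_swap_left h Φ e e y
    have c₂ := mulDefectCoboundary_swap_right h Φ y e e
    have c₃ := mulDefectCoboundary_swap_left h Φ e y e
    simp only [mulDefectCoboundary, he, hee, hye, hy.left, hy.right, map_zsmul, zero_mul, mul_zero,
      neg_mul, mul_neg, smul_neg, AddMonoidHom.zsmul_apply] at c₁ c₂ c₃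
    have hl : e * mulDefect Φ e y = (1 - i) • mulDefect Φ e y := by
      rw [sub_smul, one_smul]; grind
    have hr : mulDefect Φ e y * e = (1 - j) • mulDefect Φ e y := by
      rw [sub_smul, one_smul]; grind
    refine ⟨⟨hl, hr⟩, ?_⟩
    rw [hl, hr] at c₃
    have : (1 - j) • mulDefect Φ e y + (1 - i) • mulDefect Φ e y = (i + j) • mulDefect Φ e y := by
      rw [add_smul]; grind
    rw [← sub_eq_zero] at this
    rw [← neg_eq_zero, ← this]
    module
  have hdiag : ∀ {i j : ℤ} {y : A}, IsPeirce e i j y → i + j ≠ 1 → mulDefect Φ e y = 0 :=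
    fun hy hij => (smul_eq_zero.mp (hc hy).2).resolve_left
      (mul_ne_zero two_ne_zero (sub_ne_zero.mpr hij))
  have hoff : ∀ {i j : ℤ} {y : A}, IsPeirce e i j y → i ≠ j → mulDefect Φ e y = 0 :=
    fun {i j y} hy hij => by
      have h₂ := (hc (hy.star hs)).1
      rw [hstar] at h₂
      exact (hc hy).1.eq_zero_of_ne h₂ (Or.inl (by simpa using hij))
  obtain ⟨a, b, c, d, ha, hb, hc', hd, rfl⟩ := exists_peirce_decomposition h he y
  rw [map_add, map_add, map_add, hdiag ha (by norm_num), hoff hb (by norm_num),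
    hoff hc' (by norm_num), hdiag hd (by norm_num)]
  simp

theorem isPeirceGraded_mulDefect (hΦ : IsJordanStarDerivation Φ) (h : IsAlternative A)
    (h₁ : Φ 1 = 0) (hs : star e = e) (he : e * e = e) : IsPeirceGraded e (mulDefect Φ) := by
  have hl := hΦ.mulDefect_idem h h₁ hs he
  have hr : ∀ y, mulDefect Φ y e = 0 := fun y => by
    have := hΦ.mulDefect_eq_neg h₁ e y
    rwa [hl, hs, zero_eq_neg] at this
  constructor <;> intro y z
  · have := mulDefectCoboundary_swap_left h Φ e y z
    simp only [mulDefectCoboundary, hl, hr, zero_mul, mul_zero] at this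
    rw [map_add, AddMonoidHom.add_apply]
    grind
  · have := mulDefectCoboundary_swap_right h Φ y e z
    simp only [mulDefectCoboundary, hl, hr, zero_mul, mul_zero] at this
    rw [map_add]
    grind

theorem mulDefect_peirce (hΦ : IsJordanStarDerivation Φ) (h : IsAlternative A)
    (h₁ : Φ 1 = 0) (hs : star e = e) (he : e * e = e) {i j k l : ℤ} {y z : A}
    (hy : IsPeirce e i j y) (hz : IsPeirce e k l z) (hne : k ≠ l ∨ i + 2 * j ≠ 3 * k) :
    mulDefect Φ y z = 0 := by
  have hB := hΦ.isPeirceGraded_mulDefect h h₁ hs he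
  have h₂ := (hB.isPeirce hz (hy.star hs)).neg
  rw [← hΦ.mulDefect_eq_neg h₁] at h₂
  exact (hB.isPeirce hy hz).eq_zero_of_ne h₂ (by omega)

theorem mulDefect_diag (hΦ : IsJordanStarDerivation Φ) (h : IsAlternative A)
    (hprime : ∀ a b : A, (∀ r : A, a * r * b = 0) → a = 0 ∨ b = 0) (h₁ : Φ 1 = 0)
    (hs : star e = e) (he : e * e = e) (he1 : e ≠ 1) {y z : A}
    (hy : IsPeirce e 1 1 y) (hz : IsPeirce e 1 1 z) : mulDefect Φ y z = 0 := by
  have hB := hΦ.isPeirceGraded_mulDefect h h₁ hs he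
  have ht : IsPeirce e 1 1 (mulDefect Φ y z) := by simpa using hB.isPeirce hy hz
  refine ht.eq_zero_of_mul_eq_zero h hprime he he1 fun w hw => ?_
  have hyz := h.isPeirce_mul hy hz
  have c := (mulDefectCoboundary_swap_right h Φ y z w).trans
    (congrArg Neg.neg (mulDefectCoboundary_swap_left h Φ y w z))
  have hwy := (h.isPeirce_mul hw hy).eq_zero h he (by norm_num)
  have hwt := (h.isPeirce_mul hw ht).eq_zero h he (by norm_num)
  have d₁ := hΦ.mulDefect_peirce h h₁ hs he hyz hw (by norm_num)
  have d₂ := hΦ.mulDefect_peirce h h₁ hs he hy (h.isPeirce_mul hz hw) (by norm_num)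
  have d₃ := hΦ.mulDefect_peirce h h₁ hs he hz hw (by norm_num)
  have d₄ := hΦ.mulDefect_peirce h h₁ hs he hw hyz (by norm_num)
  have d₅ := hΦ.mulDefect_peirce h h₁ hs he hw hy (by norm_num)
  simpa [mulDefectCoboundary, hwy, hwt, d₁, d₂, d₃, d₄, d₅] using c

theorem map_mul (hΦ : IsJordanStarDerivation Φ) (h : IsAlternative A)
    (hprime : ∀ a b : A, (∀ r : A, a * r * b = 0) → a = 0 ∨ b = 0) (h₁ : Φ 1 = 0)
    (hs : star e = e) (he : e * e = e) (he0 : e ≠ 0) (he1 : e ≠ 1) (x y : A) :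
    Φ (x * y) = Φ x * y + x * Φ y := by
  suffices mulDefect Φ x y = 0 by
    rw [mulDefect_apply, sub_sub, sub_eq_zero] at this
    exact this
  obtain ⟨a, b, c, d, ha, hb, hc, hd, rfl⟩ := exists_peirce_decomposition h he x
  obtain ⟨a', b', c', d', ha', hb', hc', hd', rfl⟩ := exists_peirce_decomposition h he y
  have hp : ∀ {i j k l : ℤ} {y z : A}, IsPeirce e i j y → IsPeirce e k l z →
      (k ≠ l ∨ i + 2 * j ≠ 3 * k) → mulDefect Φ y z = 0 := hΦ.mulDefect_peirce h h₁ hs he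
  have h₂ := hΦ.mulDefect_diag h hprime h₁ hs he he1 ha ha'
  have h₃ := hΦ.mulDefect_diag h hprime h₁ (e := 1 - e) (by rw [star_sub, star_one, hs])
    (by simp [mul_sub, sub_mul, he]) (by simpa using he0) (by simpa using hd.one_sub)
    (by simpa using hd'.one_sub)
  simp only [map_add, AddMonoidHom.add_apply, h₂, h₃, hp ha hb' (by norm_num),
    hp ha hc' (by norm_num), hp ha hd' (by norm_num), hp hb ha' (by norm_num),
    hp hb hb' (by norm_num), hp hb hc' (by norm_num), hp hb hd' (by norm_num),
    hp hc ha' (by norm_num), hp hc hb' (by norm_num), hp hc hc' (by norm_num),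
    hp hc hd' (by norm_num), hp hd ha' (by norm_num), hp hd hb' (by norm_num),
    hp hd hc' (by norm_num), add_zero]

end IsJordanStarDerivation

theorem update_last_castSucc {A : Type*} {m : ℕ} (f : Fin (m + 1) → A) (v : A) (i : Fin m) :
    Function.update f (Fin.last m) v i.castSucc = f i.castSucc :=
  Function.update_of_ne (Fin.castSucc_lt_last i).ne v f

theorem update_castSucc_last {A : Type*} {m : ℕ} (f : Fin (m + 1) → A) (k : Fin m) (v : A) :
    Function.update f k.castSucc v (Fin.last m) = f (Fin.last m) :=
  Function.update_of_ne (Fin.castSucc_lt_last k).ne' v f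

theorem update_castSucc_castSucc {A : Type*} {m : ℕ} (f : Fin (m + 1) → A) (k : Fin m) (v : A)
    (i : Fin m) :
    Function.update f k.castSucc v i.castSucc = Function.update (fun j => f j.castSucc) k v i := by
  simp [Function.update_apply]

section LeftNormedProducts

variable {A : Type*} [NonAssocRing A] [StarRing A]

theorem starJordan_zero_left (b : A) : starJordan 0 b = 0 := by simp [starJordan]

theorem starJordan_add_right (a b c : A) :
    starJordan a (b + c) = starJordan a b + starJordan a c := by
  simp only [starJordan, add_mul, mul_add]; abel

theorem starJordan_nsmul_left (k : ℕ) (a b : A) : starJordan (k • a) b = k • starJordan a b := by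
  simp only [starJordan, star_nsmul, smul_mul_assoc, mul_smul_comm, smul_add]

theorem starJordan_sum_left {ι : Type*} (s : Finset ι) (f : ι → A) (b : A) :
    starJordan (∑ i ∈ s, f i) b = ∑ i ∈ s, starJordan (f i) b := by
  simp only [starJordan, star_sum, Finset.sum_mul, Finset.mul_sum, Finset.sum_add_distrib]

theorem starJordan_one_left (b : A) : starJordan 1 b = 2 • b := by
  rw [starJordan, star_one, one_mul, mul_one, two_smul]

theorem starJordan_one_right (a : A) : starJordan a 1 = a + star a := by
  rw [starJordan, one_mul, mul_one]

theorem leftStarJordan_ofFn_succ {m : ℕ} (f : Fin (m + 2) → A) :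
    leftStarJordan (List.ofFn f) =
      starJordan (leftStarJordan (List.ofFn fun i : Fin (m + 1) => f i.castSucc))
        (f (Fin.last _)) := by
  rw [List.ofFn_succ', List.concat_eq_append, List.ofFn_succ]
  simp [leftStarJordan, List.foldl_append]

theorem leftStarJordan_ofFn_one (m : ℕ) :
    leftStarJordan (List.ofFn fun _ : Fin (m + 1) => (1 : A)) = 2 ^ m • (1 : A) := by
  induction m with
  | zero => simp [leftStarJordan]
  | succ m ih =>
    rw [leftStarJordan_ofFn_succ, ih, starJordan_nsmul_left, starJordan_one_left, smul_smul,
      pow_succ]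

/-- A left-normed product with all factors but one equal to `1`. -/
theorem exists_leftStarJordan_update_one (m : ℕ) (k : Fin (m + 1)) (t : A) :
    ∃ c d : ℕ, leftStarJordan (List.ofFn (Function.update (fun _ => 1) k t)) =
      c • t + d • (t + star t) := by
  induction m with
  | zero =>
    obtain rfl : k = 0 := Fin.fin_one_eq_zero k
    exact ⟨1, 0, by simp [leftStarJordan]⟩
  | succ m ih =>
    rw [leftStarJordan_ofFn_succ]
    induction k using Fin.lastCases with
    | last =>
      simp only [update_last_castSucc, Function.update_self, leftStarJordan_ofFn_one]
      refine ⟨2 ^ m * 2, 0, ?_⟩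
      rw [starJordan_nsmul_left, starJordan_one_left, smul_smul, zero_smul, add_zero]
    | cast k =>
      obtain ⟨c, d, h⟩ := ih k
      simp only [update_castSucc_last, update_castSucc_castSucc, h]
      refine ⟨0, c + 2 * d, ?_⟩
      simp only [starJordan_one_right, star_add, star_nsmul, star_star]
      module

/-- The Leibniz rule in the last two slots, in terms of the binary product. -/
theorem exists_jordan_identity {n : ℕ} (hn : 2 ≤ n) {Φ : A → A}
    (hΦ : ∀ x y : A,
      Φ (leftStarJordan (List.ofFn (lastTwoFamily n x y))) =
        ∑ k : Fin n, leftStarJordan (List.ofFn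
          (Function.update (lastTwoFamily n x y) k (Φ (lastTwoFamily n x y k))))) :
    ∃ N c d : ℕ, N ≠ 0 ∧ ∀ x y, Φ (N • starJordan x y) =
      starJordan (starJordan (c • Φ 1 + d • (Φ 1 + star (Φ 1))) x + N • Φ x) y +
        N • starJordan x (Φ y) := by
  obtain ⟨m, rfl⟩ := Nat.exists_eq_add_of_le' hn
  rcases m with _ | m
  · refine ⟨1, 0, 0, one_ne_zero, fun x y => ?_⟩
    have := hΦ x y
    simpa [leftStarJordan, lastTwoFamily, starJordan_zero_left] using this
  · choose c d hcd using fun k => exists_leftStarJordan_update_one m k (Φ 1)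
    refine ⟨2 ^ m * 2, ∑ k, c k, ∑ k, d k, by positivity, fun x y => ?_⟩
    have h₁ : ∀ i : Fin (m + 1), lastTwoFamily (m + 1 + 2) x y i.castSucc.castSucc = 1 := by
      intro i
      have := i.isLt
      simp only [lastTwoFamily, Fin.val_castSucc]
      rw [if_neg (by omega), if_neg (by omega)]
    have h₂ : lastTwoFamily (m + 1 + 2) x y (Fin.last (m + 1)).castSucc = x := by
      simp [lastTwoFamily]
    have h₃ : lastTwoFamily (m + 1 + 2) x y (Fin.last (m + 2)) = y := by
      simp [lastTwoFamily]
    have h := hΦ x y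
    simp only [Fin.sum_univ_castSucc, leftStarJordan_ofFn_succ, update_last_castSucc,
      update_castSucc_last, update_castSucc_castSucc, Function.update_self, h₁, h₂, h₃,
      leftStarJordan_ofFn_one, hcd, ← starJordan_sum_left, Finset.sum_add_distrib,
      ← Finset.sum_smul, starJordan_nsmul_left, starJordan_one_left, smul_smul] at h
    rw [Fin.sum_univ_castSucc c, Fin.sum_univ_castSucc d]
    exact h

end LeftNormedProducts

theorem IsAddTorsionFree.of_module_complex (A : Type*) [AddCommGroup A] [Module ℂ A] :
    IsAddTorsionFree A where
  nsmul_right_injective n hn a b hab := by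
    simp only [← Nat.cast_smul_eq_nsmul ℂ] at hab
    exact (smul_right_injective A (Nat.cast_ne_zero.mpr hn)) hab

theorem isJordanLeibniz_of_jordan_identity {A : Type*} [NonAssocRing A] [StarRing A] {Φ : A → A}
    {N : ℕ} {g : A} (hN : N ≠ 0)
    (hΦ : ∀ x y, Φ (N • starJordan x y) =
      starJordan (starJordan g x + N • Φ x) y + N • starJordan x (Φ y)) :
    IsJordanLeibniz N Φ fun x => starJordan g x + N • Φ x where
  ne_zero := hN
  map_jordan := hΦ
  addDefect_eq a b := by
    simp only [addDefect, starJordan_add_right]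
    module

theorem isJordanStarDerivation_of_jordan_identity {A : Type*} [NonAssocRing A] [StarRing A]
    [IsAddTorsionFree A] {Φ : A →+ A} {N c d : ℕ} (hN : N ≠ 0)
    (hΦ : ∀ x y, Φ (N • starJordan x y) =
      starJordan (starJordan (c • Φ 1 + d • (Φ 1 + star (Φ 1))) x + N • Φ x) y +
        N • starJordan x (Φ y)) :
    IsJordanStarDerivation Φ := by
  have h₁ : ∀ y, starJordan ((c + 2 * d) • (Φ 1 + star (Φ 1)) + N • Φ 1) y = 0 := fun y => by
    have := hΦ 1 y
    rw [starJordan_one_left, map_nsmul, map_nsmul, starJordan_one_left, starJordan_one_right,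
      right_eq_add] at this
    rw [← this]
    congr 2
    simp only [star_add, star_nsmul, star_star]
    module
  have h₂ : Φ 1 + star (Φ 1) = 0 := by
    have := h₁ 1
    simp only [starJordan_one_right, star_add, star_nsmul, star_star] at this
    have h : (2 * (c + 2 * d) + N) • (Φ 1 + star (Φ 1)) = 0 := by
      rw [← this]; module
    exact (smul_eq_zero.mp h).resolve_left (by omega)
  have h₃ : ∀ y, starJordan (Φ 1) y = 0 := fun y => by
    have := h₁ y
    rw [h₂, smul_zero, zero_add, starJordan_nsmul_left] at this
    exact (smul_eq_zero.mp this).resolve_left hN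
  intro x y
  have := hΦ x y
  rw [h₂, smul_zero, add_zero, starJordan_nsmul_left, h₃, smul_zero, zero_add,
    starJordan_nsmul_left, map_nsmul, ← smul_add] at this
  exact nsmul_right_injective hN this

theorem stmt_2 {A : Type*} [NonAssocRing A] [Module ℂ A]
    [SMulCommClass ℂ A A] [IsScalarTower ℂ A A] [StarRing A]
    (halt₁ : ∀ a b : A, a * a * b = a * (a * b))
    (halt₂ : ∀ a b : A, b * a * a = b * (a * a))
    (e : A) (heStar : star e = e) (heIdem : e * e = e) (he0 : e ≠ 0) (he1 : e ≠ 1)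
    (hprime : ∀ a b : A, (∀ r : A, a * r * b = 0) → a = 0 ∨ b = 0)
    (n : ℕ) (hn : 2 ≤ n) (Φ : A → A)
    (hΦ : ∀ x y : A,
      Φ (leftStarJordan (List.ofFn (lastTwoFamily n x y))) =
        ∑ k : Fin n, leftStarJordan (List.ofFn
          (Function.update (lastTwoFamily n x y) k (Φ (lastTwoFamily n x y k))))) :
    (∀ a b : A, Φ (a + b) = Φ a + Φ b) ∧
      (∀ a b : A, Φ (a * b) = Φ a * b + a * Φ b) ∧
      (∀ a : A, Φ (star a) = star (Φ a)) := by
  have := IsAddTorsionFree.of_module_complex A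
  have halt : IsAlternative A := ⟨halt₁, halt₂⟩
  obtain ⟨N, c, d, hN, hJ⟩ := exists_jordan_identity hn hΦ
  have hadd := (isJordanLeibniz_of_jordan_identity hN hJ).map_add halt hprime heStar heIdem he0 he1
  have hD := isJordanStarDerivation_of_jordan_identity (Φ := AddMonoidHom.mk' Φ hadd) hN hJ
  have h₁ := hD.map_one halt hprime heStar heIdem he0 he1
  exact ⟨hadd, hD.map_mul halt hprime h₁ heStar heIdem he0 he1, hD.map_star h₁⟩
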